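/- arXiv:2502.05862 — 3 statements merged into one kernel-verified Lean document; each statement's English description precedes it below -/
import Mathlib

section
/- Let c > 0. There exist constants C′, c′ > 0 depending only on n and c such that for every ball B ⊆ ℝ^n of radius r_B, every integrable function f supported in B, and every integer j ≥ 3, one has ((1/|2^jB|)∫_{2^jB∖2^{j−1}B} (∫_B r_B^{−n} e^{−|x−y|²/(c r_B²)} |f(y)| dy)² dx)^{1/2} ≤ C′ e^{−c′·4^{j}}·(|B|^{−1}∫_B |f|). In particular, with α(j) = C′e^{−c′·4^{j}}, the series Σ_{j≥3} α(j)·2^{nj} converges. -/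
open MeasureTheory ENNReal Set
noncomputable section

/-- `ℝ^n` with the Euclidean norm. -/
abbrev Rn (n : ℕ) := EuclideanSpace ℝ (Fin n)

/-- The cube of center `c` and side length `r`. -/
def cube {n : ℕ} (c : Rn n) (r : ℝ) : Set (Rn n) := {y | ∀ i, |y i - c i| ≤ r / 2}

/-- `ψ_θ(Q) = (1 + r_Q/ρ(x_Q))^θ` for the cube `Q` of center `c` and side length `r`. -/
def psi {n : ℕ} (ρ : Rn n → ℝ) (θ : ℝ) (c : Rn n) (r : ℝ) : ℝ := (1 + r / ρ c) ^ θ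

/-- `ρ` is a critical radius function with constants `C₀, N₀`. -/
def IsCriticalRadiusWith {n : ℕ} (ρ : Rn n → ℝ) (C₀ N₀ : ℝ) : Prop :=
  0 < C₀ ∧ 0 < N₀ ∧ (∀ x, 0 < ρ x) ∧ ∀ x y : Rn n,
    C₀⁻¹ * ρ x * (1 + ‖x - y‖ / ρ x) ^ (-N₀) ≤ ρ y ∧
    ρ y ≤ C₀ * ρ x * (1 + ‖x - y‖ / ρ x) ^ (N₀ / (N₀ + 1))

/-- `ρ` is a critical radius function. -/
def IsCriticalRadius {n : ℕ} (ρ : Rn n → ℝ) : Prop := ∃ C₀ N₀, IsCriticalRadiusWith ρ C₀ N₀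

/-- A weight: locally integrable and a.e. positive. -/
def IsWeight {n : ℕ} (w : Rn n → ℝ) : Prop :=
  LocallyIntegrable w (volume : Measure (Rn n)) ∧ ∀ᵐ x : Rn n, 0 < w x

/-- `w(S) = ∫_S w`. -/
def wMeas {n : ℕ} (w : Rn n → ℝ) (S : Set (Rn n)) : ℝ≥0∞ :=
  ∫⁻ x in S, ENNReal.ofReal (w x)

/-- Fractional maximal operator `M_α^{ρ,θ}` associated with the critical radius function `ρ`. -/
def fracMax (n : ℕ) (ρ : Rn n → ℝ) (θ α : ℝ) (f : Rn n → ℝ) (x : Rn n) : ℝ≥0∞ :=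
  ⨆ (c : Rn n) (r : ℝ) (_ : 0 < r) (_ : x ∈ cube c r),
    ENNReal.ofReal ((psi ρ θ c r * r ^ n) ^ (α / n - 1)) *
      ∫⁻ y in cube c r, ENNReal.ofReal |f y|

/-- The Lorentz `L^{p,1}(w)` norm. -/
def lorentzP1 {n : ℕ} (p : ℝ) (w : Rn n → ℝ) (f : Rn n → ℝ) : ℝ≥0∞ :=
  ENNReal.ofReal p * ∫⁻ y in Ioi (0 : ℝ), (wMeas w {x | y < |f x|}) ^ (1 / p)

/-- The weak `L^{q,∞}(w)` quasi-norm of an `ℝ≥0∞`-valued function. -/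
def weakNormE {n : ℕ} (q : ℝ) (w : Rn n → ℝ) (F : Rn n → ℝ≥0∞) : ℝ≥0∞ :=
  ⨆ (l : ℝ) (_ : 0 < l), ENNReal.ofReal l * (wMeas w {x | ENNReal.ofReal l < F x}) ^ (1 / q)

/-- The weak `L^{q,∞}(w)` quasi-norm of a real function, with `q = ∞` allowed
(in which case it is the `w`-essential supremum). -/
def weakNormR {n : ℕ} (q : ℝ≥0∞) (w : Rn n → ℝ) (f : Rn n → ℝ) : ℝ≥0∞ :=
  if q = ∞ then
    essSup (fun x => ENNReal.ofReal |f x|)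
      ((volume : Measure (Rn n)).withDensity fun x => ENNReal.ofReal (w x))
  else ⨆ (l : ℝ) (_ : 0 < l), ENNReal.ofReal l * (wMeas w {x | l < |f x|}) ^ (1 / q.toReal)

/-- The conjugate exponent `p' = p/(p-1)` (with `1' = ∞`), as an extended real number. -/
def conjE (p : ℝ) : ℝ≥0∞ := if p = 1 then ∞ else ENNReal.ofReal (p / (p - 1))

/-- The constant `[μ,ν]_{A_{p,q,α}^{ρ,θ,R}}`. -/
def ApqR {n : ℕ} (ρ : Rn n → ℝ) (θ α p q : ℝ) (μ ν : Rn n → ℝ) : ℝ≥0∞ :=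
  ⨆ (c : Rn n) (r : ℝ) (_ : 0 < r),
    (wMeas ν (cube c r)) ^ (1 / q) *
      weakNormR (conjE p) μ ((cube c r).indicator fun x => (μ x)⁻¹) *
      ENNReal.ofReal ((r ^ n * psi ρ θ c r) ^ (α / n - 1))

/-- The constant `‖μ,ν‖_{A_{p,q,α}^{ρ,θ,R}}`. -/
def normApqR {n : ℕ} (ρ : Rn n → ℝ) (θ α p q : ℝ) (μ ν : Rn n → ℝ) : ℝ≥0∞ :=
  ⨆ (c : Rn n) (r : ℝ) (_ : 0 < r),
    (wMeas ν (cube c r)) ^ (1 / q) *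
      ⨆ (P : Set (Rn n)) (_ : MeasurableSet P) (_ : 0 < wMeas μ P) (_ : wMeas μ P ≠ ∞),
        volume (P ∩ cube c r) * ENNReal.ofReal ((r ^ n * psi ρ θ c r) ^ (α / n - 1)) *
          (wMeas μ P) ^ (-(1 / p))

/-- The constant `[w]_{A_p^{ρ,σ}}` (for `1 < p < ∞`). -/
def ApC {n : ℕ} (ρ : Rn n → ℝ) (σ p : ℝ) (w : Rn n → ℝ) : ℝ≥0∞ :=
  ⨆ (c : Rn n) (r : ℝ) (_ : 0 < r),
    (ENNReal.ofReal (psi ρ σ c r))⁻¹ *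
      ((ENNReal.ofReal (r ^ n))⁻¹ * wMeas w (cube c r)) *
      ((ENNReal.ofReal (r ^ n))⁻¹ *
        ∫⁻ y in cube c r, ENNReal.ofReal (w y ^ (1 - p / (p - 1)))) ^ (p - 1)
/-- The heat semigroup `e^{tΔ}` on `ℝ^n`. -/
def heatSg (n : ℕ) (t : ℝ) (g : Rn n → ℝ) (x : Rn n) : ℝ :=
  ∫ y : Rn n, (4 * Real.pi * t) ^ (-(n : ℝ) / 2) * Real.exp (-‖x - y‖ ^ 2 / (4 * t)) * g y

/-- The `ϱ`-variation operator of the classical heat semigroup. -/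
def varHeat (n : ℕ) (ϱ : ℝ) (g : Rn n → ℝ) (x : Rn n) : ℝ≥0∞ :=
  ⨆ (t : ℕ → ℝ) (_ : StrictAnti t) (_ : ∀ j, 0 < t j)
      (_ : Filter.Tendsto t Filter.atTop (nhds 0)),
    (∑' j : ℕ, ENNReal.ofReal (|heatSg n (t j) g x - heatSg n (t (j + 1)) g x| ^ ϱ)) ^ (1 / ϱ)

/-- Muckenhoupt `A₁`. -/
def IsA1 {n : ℕ} (w : Rn n → ℝ) : Prop :=
  ∃ C > (0 : ℝ), ∀ (c : Rn n) (r : ℝ), 0 < r →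
    wMeas w (cube c r) ≤ ENNReal.ofReal C * ENNReal.ofReal (r ^ n) *
      essInf (fun x => ENNReal.ofReal (w x)) (volume.restrict (cube c r))

/-- Muckenhoupt `A_p`, `1 < p < ∞`. -/
def IsAp {n : ℕ} (p : ℝ) (w : Rn n → ℝ) : Prop :=
  ∃ C > (0 : ℝ), ∀ (c : Rn n) (r : ℝ), 0 < r →
    wMeas w (cube c r) *
      (∫⁻ y in cube c r, ENNReal.ofReal (w y ^ (1 - p / (p - 1)))) ^ (p - 1) ≤
      ENNReal.ofReal C * (ENNReal.ofReal (r ^ n)) ^ p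

/-- Muckenhoupt `A_∞ = ∪_{p ≥ 1} A_p`. -/
def IsAinfty {n : ℕ} (w : Rn n → ℝ) : Prop := IsA1 w ∨ ∃ p > (1 : ℝ), IsAp p w

/-- The class `A₁^{ρ,loc}`, with the `A₁` condition over balls `B(x,r)`, `r ≤ ρ(x)`. -/
def IsA1loc {n : ℕ} (ρ : Rn n → ℝ) (w : Rn n → ℝ) : Prop :=
  ∃ C > (0 : ℝ), ∀ (x : Rn n) (r : ℝ), 0 < r → r ≤ ρ x →
    wMeas w (Metric.ball x r) ≤ ENNReal.ofReal C * volume (Metric.ball x r) *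
      essInf (fun y => ENNReal.ofReal (w y)) (volume.restrict (Metric.ball x r))

/-- The class `A_p^{ρ,loc}` for `1 < p < ∞`. -/
def IsAploc {n : ℕ} (ρ : Rn n → ℝ) (p : ℝ) (w : Rn n → ℝ) : Prop :=
  ∃ C > (0 : ℝ), ∀ (x : Rn n) (r : ℝ), 0 < r → r ≤ ρ x →
    wMeas w (Metric.ball x r) *
      (∫⁻ y in Metric.ball x r, ENNReal.ofReal (w y ^ (1 - p / (p - 1)))) ^ (p - 1) ≤
      ENNReal.ofReal C * (volume (Metric.ball x r)) ^ p

/-- `A_∞^{ρ,loc} = ∪_{p ≥ 1} A_p^{ρ,loc}`. -/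
def IsAinfLoc {n : ℕ} (ρ : Rn n → ℝ) (w : Rn n → ℝ) : Prop :=
  IsA1loc ρ w ∨ ∃ p > (1 : ℝ), IsAploc ρ p w

/-- The class `A₁^{ρ,θ}`. -/
def IsA1rho {n : ℕ} (ρ : Rn n → ℝ) (θ : ℝ) (w : Rn n → ℝ) : Prop :=
  ∃ C > (0 : ℝ), ∀ (c : Rn n) (r : ℝ), 0 < r →
    wMeas w (cube c r) ≤ ENNReal.ofReal (C * (psi ρ θ c r * r ^ n)) *
      essInf (fun x => ENNReal.ofReal (w x)) (volume.restrict (cube c r))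

/-- The class `A_∞^ρ(μ)`. -/
def IsAinfRhoMu {n : ℕ} (ρ : Rn n → ℝ) (μ w : Rn n → ℝ) : Prop :=
  ∃ θ ≥ (0 : ℝ), ∃ ε > (0 : ℝ), ∃ C > (0 : ℝ), ∀ (c : Rn n) (r : ℝ), 0 < r →
    ∀ E ⊆ cube c r, MeasurableSet E →
      wMeas (fun x => w x * μ x) E ≤ ENNReal.ofReal (C * psi ρ θ c r) *
        (wMeas μ E / wMeas μ (cube c r)) ^ ε * wMeas (fun x => w x * μ x) (cube c r)

/-- The class `A_∞^ρ`. -/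
def IsAinfRho {n : ℕ} (ρ : Rn n → ℝ) (w : Rn n → ℝ) : Prop :=
  ∃ θ ≥ (0 : ℝ), ∃ δ > (0 : ℝ), ∃ C > (0 : ℝ), ∀ (c : Rn n) (r : ℝ), 0 < r →
    ∀ E ⊆ cube c r, MeasurableSet E →
      wMeas w E ≤ ENNReal.ofReal (C * psi ρ θ c r) *
        (volume E / ENNReal.ofReal (r ^ n)) ^ δ * wMeas w (cube c r)

/-- Membership in `RH_∞^{ρ,θ}` with constant `C`. -/
def IsRHinf {n : ℕ} (ρ : Rn n → ℝ) (θ : ℝ) (w : Rn n → ℝ) (C : ℝ) : Prop :=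
  ∀ (c : Rn n) (r : ℝ), 0 < r →
    essSup (fun x => ENNReal.ofReal (w x)) (volume.restrict (cube c r)) ≤
      ENNReal.ofReal (C * psi ρ θ c r) * ((ENNReal.ofReal (r ^ n))⁻¹ * wMeas w (cube c r))

/-- An `η`-sparse family of cubes, encoded by their (center, side length) data. -/
def IsSparse {n : ℕ} (η : ℝ) (S : Set (Rn n × ℝ)) : Prop :=
  S.Countable ∧ (∀ Q ∈ S, 0 < Q.2) ∧
  ∃ E : Rn n × ℝ → Set (Rn n),
    (∀ Q ∈ S, MeasurableSet (E Q) ∧ E Q ⊆ cube Q.1 Q.2 ∧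
      ENNReal.ofReal η * volume (cube Q.1 Q.2) ≤ volume (E Q)) ∧
    S.PairwiseDisjoint E

/-- The sparse operator `A_S^{ρ,N}`. -/
def sparseOp {n : ℕ} (ρ : Rn n → ℝ) (N : ℝ) (S : Set (Rn n × ℝ)) (f : Rn n → ℝ)
    (x : Rn n) : ℝ≥0∞ :=
  ∑' Q : S, (cube (Q : Rn n × ℝ).1 (Q : Rn n × ℝ).2).indicator
    (fun _ => (ENNReal.ofReal ((3 * (Q : Rn n × ℝ).2) ^ n))⁻¹ *
      (∫⁻ y in cube (Q : Rn n × ℝ).1 (3 * (Q : Rn n × ℝ).2), ENNReal.ofReal |f y|) *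
      (ENNReal.ofReal (psi ρ N (Q : Rn n × ℝ).1 (Q : Rn n × ℝ).2))⁻¹) x

/-- A Gaussian in `4 ^ j` beats every exponential factor `2 ^ (n * j)`. -/
lemma summable_exp_neg_mul_four_pow_mul_two_pow (n : ℕ) (C : ℝ) {a : ℝ} (ha : 0 < a) :
    Summable (fun j : ℕ => C * Real.exp (-a * 4 ^ j) * 2 ^ (n * j)) := by
  simp_rw [mul_assoc]
  refine Summable.mul_left C (Summable.of_nonneg_of_le (fun j => by positivity) (fun j => ?_)
    (summable_geometric_two.mul_left (((n + 1).factorial : ℝ) / a ^ (n + 1))))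
  have hexp := Real.pow_div_factorial_le_exp (x := a * 4 ^ j) (by positivity) (n + 1)
  have hpos : 0 < (a * 4 ^ j) ^ (n + 1) / ((n + 1).factorial : ℝ) := by positivity
  have hpow : (2 : ℝ) ^ (n * j) * 2 ^ j ≤ (4 ^ j) ^ (n + 1) := by
    rw [← pow_add, ← pow_mul, show (4 : ℝ) = 2 ^ 2 by norm_num, ← pow_mul]
    exact pow_le_pow_right₀ one_le_two (by nlinarith)
  calc Real.exp (-a * 4 ^ j) * 2 ^ (n * j)
      ≤ ((a * 4 ^ j) ^ (n + 1) / ((n + 1).factorial : ℝ))⁻¹ * 2 ^ (n * j) := by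
        rw [neg_mul, Real.exp_neg]
        gcongr
    _ = ((n + 1).factorial : ℝ) / a ^ (n + 1) * (2 ^ (n * j) / (4 ^ j) ^ (n + 1)) := by
        rw [inv_div, mul_pow]
        field_simp
    _ ≤ ((n + 1).factorial : ℝ) / a ^ (n + 1) * (1 / 2) ^ j := by
        gcongr
        rw [one_div, inv_pow, div_le_iff₀ (by positivity), inv_mul_eq_div,
          le_div_iff₀ (by positivity)]
        exact hpow

/-- Gaussian decay between a ball and the outside of its `2 ^ (j - 1)`-fold dilate. -/
lemma exp_neg_norm_sub_sq_le {n : ℕ} {c r : ℝ} (hc : 0 < c) (hr : 0 < r) {x₀ x y : Rn n} {j : ℕ}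
    (hj : 2 ≤ j) (hx : x ∉ Metric.ball x₀ ((2 : ℝ) ^ (j - 1) * r)) (hy : y ∈ Metric.ball x₀ r) :
    Real.exp (-‖x - y‖ ^ 2 / (c * r ^ 2)) ≤ Real.exp (-(1 / (16 * c)) * 4 ^ j) := by
  obtain ⟨k, rfl⟩ := Nat.exists_eq_add_of_le' hj
  rw [Metric.mem_ball, not_lt] at hx
  rw [Metric.mem_ball] at hy
  have htri := dist_triangle x y x₀
  rw [dist_eq_norm x y] at htri
  have hdist : (2 : ℝ) ^ k * r ≤ ‖x - y‖ := by
    have h1 : (1 : ℝ) ≤ 2 ^ k := one_le_pow₀ one_le_two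
    have h2 : (2 : ℝ) ^ (k + 2 - 1) = 2 * 2 ^ k := by
      rw [show k + 2 - 1 = k + 1 by omega, pow_succ']
    rw [h2] at hx
    nlinarith
  have hsq : (4 : ℝ) ^ k * r ^ 2 ≤ ‖x - y‖ ^ 2 := by
    have h4 : (4 : ℝ) ^ k * r ^ 2 = (2 ^ k * r) ^ 2 := by
      rw [mul_pow, ← pow_mul, mul_comm k 2, pow_mul]
      norm_num
    rw [h4]
    gcongr
  rw [Real.exp_le_exp, div_le_iff₀ (by positivity)]
  have : -(1 / (16 * c)) * (4 : ℝ) ^ (k + 2) * (c * r ^ 2) = -(4 ^ k * r ^ 2) := by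
    field_simp
    ring
  rw [this]
  exact neg_le_neg hsq

/-- The normalized `L²` average over a subset of a function bounded by `K` is at most `K`. -/
lemma sqrt_average_sq_le {α : Type*} [MeasurableSpace α] {μ : Measure α} {s t : Set α}
    (hst : s ⊆ t) (hs : MeasurableSet s) {F : α → ℝ≥0∞} {K : ℝ≥0∞} (hF : ∀ x ∈ s, F x ≤ K) :
    ((μ t)⁻¹ * ∫⁻ x in s, F x ^ 2 ∂μ) ^ (1 / 2 : ℝ) ≤ K := by
  have hint : ∫⁻ x in s, F x ^ 2 ∂μ ≤ K ^ 2 * μ t :=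
    calc ∫⁻ x in s, F x ^ 2 ∂μ ≤ ∫⁻ _ in s, K ^ 2 ∂μ :=
          setLIntegral_mono' hs fun x hx => pow_le_pow_left' (hF x hx) 2
      _ = K ^ 2 * μ s := setLIntegral_const _ _
      _ ≤ K ^ 2 * μ t := by gcongr
  calc ((μ t)⁻¹ * ∫⁻ x in s, F x ^ 2 ∂μ) ^ (1 / 2 : ℝ)
      ≤ ((μ t)⁻¹ * (K ^ 2 * μ t)) ^ (1 / 2 : ℝ) := by gcongr
    _ = (((μ t)⁻¹ * μ t) * K ^ 2) ^ (1 / 2 : ℝ) := by ring_nf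
    _ ≤ (1 * K ^ 2) ^ (1 / 2 : ℝ) := by
        gcongr
        exact ENNReal.inv_mul_le_one _
    _ = K := by
        rw [one_mul, ← ENNReal.rpow_natCast, ← ENNReal.rpow_mul]
        norm_num

/-- `L²` off-diagonal Gaussian decay on dyadic annuli, with constants
depending only on `n` and `c`; in particular `Σ_j α(j)·2^{nj} < ∞`. -/
theorem statement17 (n : ℕ) (c : ℝ) (hc : 0 < c) :
    ∃ C' c' : ℝ, 0 < C' ∧ 0 < c' ∧
      (∀ (x₀ : Rn n) (rB : ℝ), 0 < rB →
        ∀ f : Rn n → ℝ, Integrable f (volume : Measure (Rn n)) →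
          (∀ y ∉ Metric.ball x₀ rB, f y = 0) →
        ∀ j : ℕ, 3 ≤ j →
          ((volume (Metric.ball x₀ ((2 : ℝ) ^ j * rB)))⁻¹ *
              ∫⁻ x in Metric.ball x₀ ((2 : ℝ) ^ j * rB) \
                  Metric.ball x₀ ((2 : ℝ) ^ (j - 1) * rB),
                (∫⁻ y in Metric.ball x₀ rB,
                  ENNReal.ofReal
                    (rB ^ (-(n : ℝ)) * Real.exp (-‖x - y‖ ^ 2 / (c * rB ^ 2)) * |f y|)) ^ 2) ^
              (1 / 2 : ℝ) ≤
            ENNReal.ofReal (C' * Real.exp (-c' * 4 ^ j)) *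
              ((volume (Metric.ball x₀ rB))⁻¹ *
                ∫⁻ y in Metric.ball x₀ rB, ENNReal.ofReal |f y|)) ∧
      Summable (fun j : ℕ => C' * Real.exp (-c' * 4 ^ j) * 2 ^ (n * j)) := by
  set ω : ℝ≥0∞ := volume (Metric.ball (0 : Rn n) 1)
  have hω_pos : 0 < ω := Metric.measure_ball_pos _ _ one_pos
  have hω_top : ω ≠ ∞ := measure_ball_lt_top.ne
  refine ⟨ω.toReal, 1 / (16 * c), ENNReal.toReal_pos hω_pos.ne' hω_top, by positivity, ?_,
    summable_exp_neg_mul_four_pow_mul_two_pow n _ (by positivity)⟩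
  intro x₀ r hr f _ _ j hj
  set E : ℝ := Real.exp (-(1 / (16 * c)) * 4 ^ j)
  set I : ℝ≥0∞ := ∫⁻ y in Metric.ball x₀ r, ENNReal.ofReal |f y|
  have hball : volume (Metric.ball x₀ r) = ENNReal.ofReal (r ^ n) * ω := by
    rw [Measure.addHaar_ball_of_pos volume x₀ hr, finrank_euclideanSpace_fin]
  have hball_pos : volume (Metric.ball x₀ r) ≠ 0 := (Metric.measure_ball_pos _ _ hr).ne'
  have hball_top : volume (Metric.ball x₀ r) ≠ ∞ := measure_ball_lt_top.ne
  have hconst : ENNReal.ofReal (r ^ (-(n : ℝ)) * E) * I =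
      ENNReal.ofReal (ω.toReal * E) * ((volume (Metric.ball x₀ r))⁻¹ * I) := by
    have hvol : ENNReal.ofReal (r ^ (-(n : ℝ))) * volume (Metric.ball x₀ r) = ω := by
      rw [hball, ← mul_assoc, ← ENNReal.ofReal_mul (by positivity), Real.rpow_neg hr.le,
        Real.rpow_natCast, inv_mul_cancel₀ (by positivity), ENNReal.ofReal_one, one_mul]
    rw [ENNReal.ofReal_mul (by positivity), ENNReal.ofReal_mul ENNReal.toReal_nonneg,
      ENNReal.ofReal_toReal hω_top, ← hvol]
    calc _ = ENNReal.ofReal (r ^ (-(n : ℝ))) * ENNReal.ofReal E * I *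
          (volume (Metric.ball x₀ r) * (volume (Metric.ball x₀ r))⁻¹) := by
          rw [ENNReal.mul_inv_cancel hball_pos hball_top, mul_one]
      _ = _ := by ring
  rw [← hconst]
  refine sqrt_average_sq_le sdiff_subset (measurableSet_ball.diff measurableSet_ball)
    fun x hx => ?_
  rw [← lintegral_const_mul' _ _ ENNReal.ofReal_ne_top]
  refine setLIntegral_mono' measurableSet_ball fun y hy => ?_
  rw [← ENNReal.ofReal_mul (by positivity)]
  have hexp := exp_neg_norm_sub_sq_le hc hr (by omega) hx.2 hy
  gcongr
end
end

section
/- Let ρ be a critical radius function on ℝ^n, let σ > 0 and c > 0. There is a constant C depending only on n, σ and c such that for every x₀ ∈ ℝ^n, every locally integrable f, and every x in the ball B = B(x₀, ρ(x₀)), one has ∫_0^∞ ∫_{ℝ^n ∖ 3B} t^{−n/2} (1 + √t/ρ(x₀))^{−σ−1} e^{−|x−y|²/(ct)} |f(y)| dy (dt/t) ≤ C·M^{ρ,σ}f(x), where 3B is the ball with the same center as B and three times its radius. -/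
open MeasureTheory ENNReal Set
noncomputable section

/-- A Gaussian decays faster than any power. -/
lemma exp_neg_le_div_rpow {p u : ℝ} (hp : 0 < p) (hu : 0 < u) :
    Real.exp (-u) ≤ (p / u) ^ p := by
  have h1 : (u / p) ^ p ≤ Real.exp u := by
    calc (u / p) ^ p ≤ (Real.exp (u / p)) ^ p := by
          gcongr
          linarith [Real.add_one_le_exp (u / p)]
      _ = Real.exp u := by
          rw [← Real.exp_mul, div_mul_cancel₀ _ hp.ne']
  rw [Real.exp_neg, ← inv_div u p, Real.inv_rpow (by positivity)]
  gcongr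

/-- The time integral of the truncated power `t^{σ/2-3/4} (1 + √t/R)^{-σ-1}`. -/
lemma lintegral_rpow_mul_one_add_sqrt_le {σ R : ℝ} (hσ : 0 < σ) (hR : 0 < R) :
    ∫⁻ t in Ioi (0 : ℝ), ENNReal.ofReal
        (t ^ (σ / 2 - 3 / 4) * (1 + Real.sqrt t / R) ^ (-σ - 1)) ≤
      ENNReal.ofReal (8 * R ^ (σ + 1 / 2)) := by
  have hR2 : (0 : ℝ) < R ^ 2 := by positivity
  have hsmall : ∫⁻ t in Ioc (0 : ℝ) (R ^ 2), ENNReal.ofReal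
      (t ^ (σ / 2 - 3 / 4) * (1 + Real.sqrt t / R) ^ (-σ - 1)) ≤
      ENNReal.ofReal (4 * R ^ (σ + 1 / 2)) := by
    have hint : IntervalIntegrable (fun t : ℝ => t ^ (σ / 2 - 3 / 4)) volume 0 (R ^ 2) :=
      intervalIntegral.intervalIntegrable_rpow' (by linarith)
    calc _ ≤ ∫⁻ t in Ioc (0 : ℝ) (R ^ 2), ENNReal.ofReal (t ^ (σ / 2 - 3 / 4)) := by
          refine setLIntegral_mono' measurableSet_Ioc fun t ht => ENNReal.ofReal_le_ofReal ?_
          refine mul_le_of_le_one_right (Real.rpow_nonneg ht.1.le _) ?_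
          refine Real.rpow_le_one_of_one_le_of_nonpos ?_ (by linarith)
          have : 0 ≤ Real.sqrt t / R := by positivity
          linarith
      _ = ENNReal.ofReal (∫ t in Ioc (0 : ℝ) (R ^ 2), t ^ (σ / 2 - 3 / 4)) := by
          rw [ofReal_integral_eq_lintegral_ofReal]
          · exact (intervalIntegrable_iff_integrableOn_Ioc_of_le hR2.le).1 hint
          · filter_upwards [ae_restrict_mem measurableSet_Ioc] with t ht
            exact Real.rpow_nonneg ht.1.le _
      _ ≤ _ := by
          refine ENNReal.ofReal_le_ofReal ?_
          rw [← intervalIntegral.integral_of_le hR2.le, integral_rpow (Or.inl (by linarith)),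
            Real.zero_rpow (by linarith), sub_zero, ← Real.rpow_natCast, ← Real.rpow_mul hR.le,
            div_le_iff₀ (by linarith)]
          rw [show ((2 : ℕ) : ℝ) * (σ / 2 - 3 / 4 + 1) = σ + 1 / 2 by push_cast; ring]
          have : 0 < R ^ (σ + 1 / 2) := by positivity
          nlinarith
  have hlarge : ∫⁻ t in Ioi (R ^ 2), ENNReal.ofReal
      (t ^ (σ / 2 - 3 / 4) * (1 + Real.sqrt t / R) ^ (-σ - 1)) ≤
      ENNReal.ofReal (4 * R ^ (σ + 1 / 2)) := by
    calc _ ≤ ∫⁻ t in Ioi (R ^ 2), ENNReal.ofReal (R ^ (σ + 1) * t ^ (-(5 / 4) : ℝ)) := by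
          refine setLIntegral_mono' measurableSet_Ioi fun t ht => ENNReal.ofReal_le_ofReal ?_
          have ht0 : 0 < t := hR2.trans ht
          calc t ^ (σ / 2 - 3 / 4) * (1 + Real.sqrt t / R) ^ (-σ - 1)
              ≤ t ^ (σ / 2 - 3 / 4) * (Real.sqrt t / R) ^ (-σ - 1) := by
                refine mul_le_mul_of_nonneg_left ?_ (by positivity)
                exact Real.rpow_le_rpow_of_nonpos (by positivity) (by linarith) (by linarith)
            _ = R ^ (σ + 1) * t ^ (-(5 / 4) : ℝ) := by
                rw [Real.div_rpow (by positivity) hR.le, Real.sqrt_eq_rpow,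
                  ← Real.rpow_mul ht0.le, show -σ - 1 = -(σ + 1) by ring, Real.rpow_neg hR.le,
                  div_inv_eq_mul, ← mul_assoc, ← Real.rpow_add ht0, mul_comm]
                congr 2
                ring
      _ = ENNReal.ofReal (∫ t in Ioi (R ^ 2), R ^ (σ + 1) * t ^ (-(5 / 4) : ℝ)) := by
          rw [ofReal_integral_eq_lintegral_ofReal]
          · exact (integrableOn_Ioi_rpow_of_lt (by norm_num) hR2).const_mul _
          · filter_upwards [ae_restrict_mem measurableSet_Ioi] with t ht
            have ht0 : 0 < t := hR2.trans ht
            positivity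
      _ ≤ _ := by
          refine ENNReal.ofReal_le_ofReal (le_of_eq ?_)
          rw [integral_const_mul, integral_Ioi_rpow_of_lt (by norm_num) hR2,
            ← Real.rpow_natCast, ← Real.rpow_mul hR.le]
          rw [show σ + 1 / 2 = σ + 1 + ((2 : ℕ) : ℝ) * (-(5 / 4) + 1) by push_cast; ring,
            Real.rpow_add hR (σ + 1)]
          ring
  rw [← Ioc_union_Ioi_eq_Ioi hR2.le]
  refine (lintegral_union_le _ _ _).trans ((add_le_add hsmall hlarge).trans (le_of_eq ?_))
  rw [← ENNReal.ofReal_add (by positivity) (by positivity)]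
  congr 1
  ring

/-- Integrals over cubes containing `x` are controlled by the maximal function at `x`. -/
lemma setLIntegral_cube_le_fracMax {n : ℕ} {ρ : Rn n → ℝ} (hρ : ∀ x, 0 < ρ x) (σ : ℝ)
    (f : Rn n → ℝ) {x z : Rn n} {r : ℝ} (hr : 0 < r) (hx : x ∈ cube z r) :
    ∫⁻ y in cube z r, ENNReal.ofReal |f y| ≤
      ENNReal.ofReal (psi ρ σ z r * r ^ n) * fracMax n ρ σ 0 f x := by
  have hz := hρ z
  have hP : 0 < psi ρ σ z r * r ^ n := by unfold psi; positivity
  have h : ENNReal.ofReal ((psi ρ σ z r * r ^ n) ^ ((0 : ℝ) / n - 1)) *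
      ∫⁻ y in cube z r, ENNReal.ofReal |f y| ≤ fracMax n ρ σ 0 f x :=
    le_iSup₂_of_le z r (le_iSup₂_of_le hr hx le_rfl)
  rw [zero_div, zero_sub, Real.rpow_neg_one, ENNReal.ofReal_inv_of_pos hP] at h
  rwa [← ENNReal.inv_mul_le_iff (by simpa using hP) ENNReal.ofReal_ne_top]

lemma ball_subset_cube {n : ℕ} (z : Rn n) (r : ℝ) : Metric.ball z r ⊆ cube z (2 * r) := by
  intro y hy i
  have h := (PiLp.norm_apply_le (y - z) i).trans (mem_ball_iff_norm.1 hy).le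
  simpa using h

/-- Off a ball of radius `ρ z`, integrals against a power of the distance to `z` are controlled
by the maximal function at the points near `z`. -/
lemma setLIntegral_compl_ball_le_fracMax {n : ℕ} {ρ : Rn n → ℝ} (hρ : ∀ x, 0 < ρ x) {σ : ℝ}
    (hσ : 0 < σ) (f : Rn n → ℝ) {x z : Rn n} (hx : x ∈ Metric.ball z (ρ z)) :
    ∫⁻ y in (Metric.ball z (ρ z))ᶜ,
        ENNReal.ofReal (‖y - z‖ ^ (-(n + σ + 1 / 2)) * |f y|) ≤
      ENNReal.ofReal (5 ^ σ * 4 ^ n * (1 - 2 ^ (-(1 / 2) : ℝ))⁻¹ * (ρ z) ^ (-(σ + 1 / 2))) *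
        fracMax n ρ σ 0 f x := by
  set R := ρ z with hRdef
  have hR : 0 < R := hρ z
  set q : ℝ := 2 ^ (-(1 / 2) : ℝ) with hq
  have hq0 : 0 < q := by positivity
  have hq1 : q < 1 := Real.rpow_lt_one_of_one_lt_of_neg (by norm_num) (by norm_num)
  let A : ℕ → Set (Rn n) := fun k =>
    {y | 2 ^ k * R ≤ ‖y - z‖} ∩ Metric.ball z (2 ^ (k + 1) * R)
  have hA : ∀ k, MeasurableSet (A k) := fun k =>
    (measurableSet_le (by fun_prop) (by fun_prop)).inter measurableSet_ball
  have hcover : (Metric.ball z R)ᶜ ⊆ ⋃ k, A k := by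
    intro y hy
    have hy' : 1 ≤ ‖y - z‖ / R := by
      rw [one_le_div hR]
      simpa [dist_eq_norm] using hy
    obtain ⟨k, hk1, hk2⟩ := exists_nat_pow_near hy' one_lt_two
    refine mem_iUnion.2 ⟨k, (le_div_iff₀ hR).1 hk1, mem_ball_iff_norm.2 ((div_lt_iff₀ hR).1 hk2)⟩
  have hterm : ∀ k, ∫⁻ y in A k, ENNReal.ofReal (‖y - z‖ ^ (-(n + σ + 1 / 2)) * |f y|) ≤
      ENNReal.ofReal (5 ^ σ * 4 ^ n * R ^ (-(σ + 1 / 2)) * q ^ k) * fracMax n ρ σ 0 f x := by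
    intro k
    have hb : (0 : ℝ) < 2 ^ k := by positivity
    have hb1 : (1 : ℝ) ≤ 2 ^ k := one_le_pow₀ one_le_two
    have hsub : Metric.ball z (2 ^ (k + 1) * R) ⊆ cube z (2 * (2 ^ (k + 1) * R)) :=
      ball_subset_cube z _
    have hxc : x ∈ cube z (2 * (2 ^ (k + 1) * R)) := by
      refine hsub (Metric.ball_subset_ball ?_ hx)
      exact le_mul_of_one_le_left hR.le (one_le_pow₀ one_le_two)
    calc _ ≤ ∫⁻ y in A k, ENNReal.ofReal ((2 ^ k * R) ^ (-(n + σ + 1 / 2))) *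
            ENNReal.ofReal |f y| := by
          refine setLIntegral_mono' (hA k) fun y hy => ?_
          rw [← ENNReal.ofReal_mul (by positivity)]
          refine ENNReal.ofReal_le_ofReal (mul_le_mul_of_nonneg_right ?_ (abs_nonneg _))
          exact Real.rpow_le_rpow_of_nonpos (by positivity) hy.1
            (by have : (0 : ℝ) ≤ n := n.cast_nonneg; linarith)
      _ = ENNReal.ofReal ((2 ^ k * R) ^ (-(n + σ + 1 / 2))) *
            ∫⁻ y in A k, ENNReal.ofReal |f y| := lintegral_const_mul' _ _ ENNReal.ofReal_ne_top
      _ ≤ ENNReal.ofReal ((2 ^ k * R) ^ (-(n + σ + 1 / 2))) *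
            (ENNReal.ofReal (psi ρ σ z (2 * (2 ^ (k + 1) * R)) * (2 * (2 ^ (k + 1) * R)) ^ n) *
              fracMax n ρ σ 0 f x) := by
          gcongr
          exact (lintegral_mono_set (inter_subset_right.trans hsub)).trans
            (setLIntegral_cube_le_fracMax hρ σ f (by positivity) hxc)
      _ ≤ _ := by
          rw [← mul_assoc, ← ENNReal.ofReal_mul (by positivity)]
          gcongr ENNReal.ofReal ?_ * _
          have hpsi : psi ρ σ z (2 * (2 ^ (k + 1) * R)) ≤ 5 ^ σ * (2 ^ k) ^ σ := by
            unfold psi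
            rw [← Real.mul_rpow (by norm_num) hb.le, ← hRdef]
            refine Real.rpow_le_rpow (by positivity) ?_ hσ.le
            rw [← mul_assoc, mul_div_cancel_right₀ _ hR.ne', pow_succ]
            linarith
          have hqk : q ^ k = ((2 : ℝ) ^ k) ^ (-(1 / 2) : ℝ) := by
            rw [hq, ← Real.rpow_natCast, ← Real.rpow_natCast, ← Real.rpow_mul (by norm_num),
              ← Real.rpow_mul (by norm_num), mul_comm]
          calc (2 ^ k * R) ^ (-(n + σ + 1 / 2)) *
                (psi ρ σ z (2 * (2 ^ (k + 1) * R)) * (2 * (2 ^ (k + 1) * R)) ^ n)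
              ≤ (2 ^ k * R) ^ (-(n + σ + 1 / 2)) *
                (5 ^ σ * (2 ^ k) ^ σ * (2 * (2 ^ (k + 1) * R)) ^ n) := by gcongr
            _ = 5 ^ σ * 4 ^ n * R ^ (-(σ + 1 / 2)) * q ^ k := by
                rw [hqk, show 2 * ((2 : ℝ) ^ (k + 1) * R) = 4 * (2 ^ k * R) by ring,
                  mul_pow 4 _ n]
                generalize (2 : ℝ) ^ k = b at hb
                rw [show -((n : ℝ) + σ + 1 / 2) = -(n : ℝ) + -(σ + 1 / 2) by ring,
                  Real.rpow_add (by positivity), Real.rpow_neg (by positivity),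
                  Real.rpow_natCast, Real.mul_rpow hb.le hR.le,
                  show -(1 / 2 : ℝ) = -(σ + 1 / 2) + σ by ring, Real.rpow_add hb]
                have : (b * R) ^ n ≠ 0 := by positivity
                field_simp
  calc _ ≤ ∫⁻ y in ⋃ k, A k, ENNReal.ofReal (‖y - z‖ ^ (-(n + σ + 1 / 2)) * |f y|) :=
        lintegral_mono_set hcover
    _ ≤ ∑' k, ∫⁻ y in A k, ENNReal.ofReal (‖y - z‖ ^ (-(n + σ + 1 / 2)) * |f y|) :=
        lintegral_iUnion_le _ _
    _ ≤ ∑' k, ENNReal.ofReal (5 ^ σ * 4 ^ n * R ^ (-(σ + 1 / 2)) * q ^ k) *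
          fracMax n ρ σ 0 f x := ENNReal.tsum_le_tsum hterm
    _ = _ := by
        rw [ENNReal.tsum_mul_right, ← ENNReal.ofReal_tsum_of_nonneg (fun k => by positivity)
          ((summable_geometric_of_lt_one hq0.le hq1).mul_left _), tsum_mul_left,
          tsum_geometric_of_lt_one hq0.le hq1]
        congr 2
        ring

/-- The global part of the variation of the heat semigroup is dominated by
`M^{ρ,σ}`, with a constant depending only on `n`, `σ` and `c`. -/
theorem statement18 (n : ℕ) (σ c : ℝ) (hσ : 0 < σ) (hc : 0 < c) :
    ∃ C : ℝ, 0 < C ∧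
      ∀ (ρ : Rn n → ℝ), IsCriticalRadius ρ →
      ∀ x₀ : Rn n,
      ∀ f : Rn n → ℝ, Measurable f → LocallyIntegrable f (volume : Measure (Rn n)) →
      ∀ x ∈ Metric.ball x₀ (ρ x₀),
        (∫⁻ t in Set.Ioi (0 : ℝ),
            (∫⁻ y in (Metric.ball x₀ (3 * ρ x₀))ᶜ,
              ENNReal.ofReal (t ^ (-(n : ℝ) / 2) * (1 + Real.sqrt t / ρ x₀) ^ (-σ - 1) *
                Real.exp (-‖x - y‖ ^ 2 / (c * t)) * |f y|)) * ENNReal.ofReal t⁻¹) ≤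
          ENNReal.ofReal C * fracMax n ρ σ 0 f x := by
  set p : ℝ := (n + σ + 1 / 2) / 2 with hp
  have hp0 : 0 < p := by positivity
  set K : ℝ := (p * c * (9 / 4)) ^ p with hK
  have hK0 : 0 < K := by positivity
  set D : ℝ := 5 ^ σ * 4 ^ n * (1 - 2 ^ (-(1 / 2) : ℝ))⁻¹ with hD
  have hD0 : 0 < D := by
    have : (2 : ℝ) ^ (-(1 / 2) : ℝ) < 1 :=
      Real.rpow_lt_one_of_one_lt_of_neg (by norm_num) (by norm_num)
    have := inv_pos.2 (sub_pos.2 this)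
    positivity
  refine ⟨K * 8 * D, by positivity, fun ρ hρ x₀ f _ _ x hx => ?_⟩
  obtain ⟨_, _, _, _, hρ, _⟩ := hρ
  set R := ρ x₀ with hRdef
  have hR : 0 < R := hρ x₀
  set I := ∫⁻ y in (Metric.ball x₀ (3 * R))ᶜ,
    ENNReal.ofReal (‖y - x₀‖ ^ (-(n + σ + 1 / 2)) * |f y|) with hI
  have hIle : I ≤ ENNReal.ofReal (D * R ^ (-(σ + 1 / 2))) * fracMax n ρ σ 0 f x := by
    refine le_trans (lintegral_mono_set ?_) (setLIntegral_compl_ball_le_fracMax hρ hσ f hx)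
    exact compl_subset_compl.2 (Metric.ball_subset_ball (by linarith))
  have hkernel : ∀ t, 0 < t → ∀ y ∈ (Metric.ball x₀ (3 * R))ᶜ,
      Real.exp (-‖x - y‖ ^ 2 / (c * t)) ≤ K * t ^ p * ‖y - x₀‖ ^ (-(n + σ + 1 / 2)) := by
    intro t ht y hy
    have hy3 : 3 * R ≤ ‖y - x₀‖ := by simpa [dist_eq_norm] using hy
    have hxR : ‖x - x₀‖ < R := mem_ball_iff_norm.1 hx
    have htri : ‖y - x₀‖ ≤ ‖x - y‖ + ‖x - x₀‖ := by
      rw [norm_sub_rev x y]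
      exact norm_sub_le_norm_sub_add_norm_sub _ _ _
    have hd : 0 < ‖y - x₀‖ := by linarith
    have hdist : 2 / 3 * ‖y - x₀‖ ≤ ‖x - y‖ := by linarith
    have hxy : 0 < ‖x - y‖ := by linarith
    calc Real.exp (-‖x - y‖ ^ 2 / (c * t)) = Real.exp (-(‖x - y‖ ^ 2 / (c * t))) := by
          rw [neg_div]
      _ ≤ (p / (‖x - y‖ ^ 2 / (c * t))) ^ p := exp_neg_le_div_rpow hp0 (by positivity)
      _ ≤ (p / ((2 / 3 * ‖y - x₀‖) ^ 2 / (c * t))) ^ p := by gcongr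
      _ = (p * c * (9 / 4) * t * (‖y - x₀‖ ^ 2)⁻¹) ^ p := by
          congr 1
          field_simp
          norm_num
      _ = K * t ^ p * ‖y - x₀‖ ^ (-(n + σ + 1 / 2)) := by
          rw [Real.mul_rpow (by positivity) (by positivity), Real.mul_rpow (by positivity) ht.le,
            Real.inv_rpow (by positivity), ← Real.rpow_natCast, ← Real.rpow_mul hd.le,
            ← Real.rpow_neg hd.le]
          congr 2
          rw [hp]
          push_cast
          ring
  have hinner : ∀ t ∈ Ioi (0 : ℝ),
      (∫⁻ y in (Metric.ball x₀ (3 * R))ᶜ,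
        ENNReal.ofReal (t ^ (-(n : ℝ) / 2) * (1 + Real.sqrt t / R) ^ (-σ - 1) *
          Real.exp (-‖x - y‖ ^ 2 / (c * t)) * |f y|)) * ENNReal.ofReal t⁻¹ ≤
      ENNReal.ofReal (t ^ (σ / 2 - 3 / 4) * (1 + Real.sqrt t / R) ^ (-σ - 1)) *
        (ENNReal.ofReal K * I) := by
    intro t ht
    have ht0 : 0 < t := ht
    have hpow : t ^ (-(n : ℝ) / 2) * t ^ p * t⁻¹ = t ^ (σ / 2 - 3 / 4) := by
      rw [← Real.rpow_neg_one t, ← Real.rpow_add ht0, ← Real.rpow_add ht0]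
      congr 1
      rw [hp]
      ring
    set W : ℝ := (1 + Real.sqrt t / R) ^ (-σ - 1) with hW
    have hW0 : 0 ≤ W := by positivity
    calc _ ≤ (∫⁻ y in (Metric.ball x₀ (3 * R))ᶜ,
            ENNReal.ofReal (t ^ (-(n : ℝ) / 2) * W * (K * t ^ p)) *
              ENNReal.ofReal (‖y - x₀‖ ^ (-(n + σ + 1 / 2)) * |f y|)) * ENNReal.ofReal t⁻¹ := by
          gcongr ?_ * _
          refine setLIntegral_mono' measurableSet_ball.compl fun y hy => ?_
          rw [← ENNReal.ofReal_mul (by positivity)]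
          refine ENNReal.ofReal_le_ofReal ?_
          rw [← mul_assoc, mul_assoc _ (K * t ^ p)]
          gcongr
          exact hkernel t ht0 y hy
      _ = ENNReal.ofReal (t ^ (σ / 2 - 3 / 4) * W) * (ENNReal.ofReal K * I) := by
          rw [lintegral_const_mul' _ _ ENNReal.ofReal_ne_top, ← hI, mul_right_comm,
            ← mul_assoc (ENNReal.ofReal _) _ I, ← ENNReal.ofReal_mul (by positivity),
            ← ENNReal.ofReal_mul (by positivity), ← hpow]
          congr 2
          ring
  calc _ ≤ ∫⁻ t in Ioi (0 : ℝ),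
          ENNReal.ofReal (t ^ (σ / 2 - 3 / 4) * (1 + Real.sqrt t / R) ^ (-σ - 1)) *
            (ENNReal.ofReal K * I) := setLIntegral_mono' measurableSet_Ioi hinner
    _ = (∫⁻ t in Ioi (0 : ℝ),
          ENNReal.ofReal (t ^ (σ / 2 - 3 / 4) * (1 + Real.sqrt t / R) ^ (-σ - 1))) *
            (ENNReal.ofReal K * I) := lintegral_mul_const _ (by fun_prop)
    _ ≤ ENNReal.ofReal (8 * R ^ (σ + 1 / 2)) * (ENNReal.ofReal K *
          (ENNReal.ofReal (D * R ^ (-(σ + 1 / 2))) * fracMax n ρ σ 0 f x)) := by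
        gcongr
        exact lintegral_rpow_mul_one_add_sqrt_le hσ hR
    _ = ENNReal.ofReal (K * 8 * D) * fracMax n ρ σ 0 f x := by
        rw [← mul_assoc, ← mul_assoc, ← ENNReal.ofReal_mul (by positivity),
          ← ENNReal.ofReal_mul (by positivity), Real.rpow_neg hR.le]
        congr 2
        have : R ^ (σ + 1 / 2) ≠ 0 := by positivity
        field_simp
end
end

section
/- Let ρ be a critical radius function on ℝ^n, let σ > 0 and c > 0. There is a constant C depending only on n, σ and c such that for every locally integrable f, every x ∈ ℝ^n, and every t with 0 < t < ρ(x)², one has ∫_{ℝ^n} t^{−n/2} e^{−c|x−y|²/t} |f(y)| dy ≤ C·M^{ρ,σ}f(x). -/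
open MeasureTheory ENNReal Set
noncomputable section

lemma measurableSet_cube {n : ℕ} (c : Rn n) (r : ℝ) : MeasurableSet (cube c r) := by
  have : cube c r = ⋂ i, {y : Rn n | |y i - c i| ≤ r / 2} := by
    ext y
    simp [cube]
  rw [this]
  exact MeasurableSet.iInter fun i => measurableSet_le (by fun_prop) measurable_const

lemma mem_cube_of_norm_sub_le {n : ℕ} {c y : Rn n} {r : ℝ} (h : ‖c - y‖ ≤ r / 2) :
    y ∈ cube c r := by
  intro i
  have h1 := PiLp.norm_apply_le (c - y) i
  rw [PiLp.sub_apply, Real.norm_eq_abs, abs_sub_comm] at h1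
  exact h1.trans h

/-- The integral of `|f|` over a cube containing `x` is at most `ψ_σ(Q)|Q| M^{ρ,σ}f(x)`. -/
lemma lintegral_cube_le_fracMax {n : ℕ} (ρ : Rn n → ℝ) (σ : ℝ) (f : Rn n → ℝ) {x c : Rn n}
    {r : ℝ} (hr : 0 < r) (hx : x ∈ cube c r) (hρ : 0 < ρ c) :
    ∫⁻ y in cube c r, ENNReal.ofReal |f y| ≤
      ENNReal.ofReal (psi ρ σ c r * r ^ n) * fracMax n ρ σ 0 f x := by
  have hA : 0 < psi ρ σ c r * r ^ n := by
    unfold psi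
    positivity
  have h : ENNReal.ofReal ((psi ρ σ c r * r ^ n) ^ ((0 : ℝ) / n - 1)) *
      ∫⁻ y in cube c r, ENNReal.ofReal |f y| ≤ fracMax n ρ σ 0 f x := by
    unfold fracMax
    exact le_iSup_of_le c (le_iSup_of_le r (le_iSup_of_le hr (le_iSup_of_le hx le_rfl)))
  rw [zero_div, zero_sub, Real.rpow_neg_one] at h
  calc ∫⁻ y in cube c r, ENNReal.ofReal |f y|
      = ENNReal.ofReal (psi ρ σ c r * r ^ n) *
        (ENNReal.ofReal (psi ρ σ c r * r ^ n)⁻¹ * ∫⁻ y in cube c r, ENNReal.ofReal |f y|) := by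
        rw [← mul_assoc, ← ENNReal.ofReal_mul hA.le, mul_inv_cancel₀ hA.ne', ENNReal.ofReal_one,
          one_mul]
    _ ≤ _ := by gcongr

lemma summable_exp_mul_pow {c : ℝ} (hc : 0 < c) (m : ℕ) :
    Summable fun k : ℕ => Real.exp (-c * k) * (2 * (k : ℝ) + 3) ^ m := by
  have h := summable_pow_mul_geometric_of_norm_lt_one m (r := Real.exp (-c))
    (by rw [Real.norm_of_nonneg (Real.exp_pos _).le, Real.exp_lt_one_iff]; linarith)
  have h2 := ((summable_nat_add_iff 1).2 h).mul_left (3 ^ m * (Real.exp (-c))⁻¹)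
  refine h2.of_nonneg_of_le (fun k => by positivity) fun k => ?_
  have he : Real.exp (-c * k) = Real.exp (-c) ^ k := by
    rw [← Real.exp_nat_mul, mul_comm]
  have hp : (2 * (k : ℝ) + 3) ^ m ≤ 3 ^ m * ((k : ℝ) + 1) ^ m := by
    rw [← mul_pow]
    gcongr
    have : (0 : ℝ) ≤ k := k.cast_nonneg
    linarith
  calc Real.exp (-c * k) * (2 * (k : ℝ) + 3) ^ m
      ≤ Real.exp (-c) ^ k * (3 ^ m * ((k : ℝ) + 1) ^ m) := by rw [he]; gcongr
    _ = _ := by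
      push_cast
      have := Real.exp_pos (-c)
      rw [pow_succ]
      field_simp

/-- The Gaussian is dominated by a superposition of indicators of concentric cubes. -/
lemma ofReal_gaussian_mul_le_tsum {n : ℕ} {c t : ℝ} (hc : 0 < c) (ht : 0 < t) (f : Rn n → ℝ)
    (x y : Rn n) :
    ENNReal.ofReal (t ^ (-(n : ℝ) / 2) * Real.exp (-c * ‖x - y‖ ^ 2 / t) * |f y|) ≤
      ∑' k : ℕ, ENNReal.ofReal (t ^ (-(n : ℝ) / 2) * Real.exp (-c * k)) *
        (cube x (2 * ((k : ℝ) + 1) * √t)).indicator (fun y => ENNReal.ofReal |f y|) y := by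
  have hs : 0 < √t := Real.sqrt_pos.2 ht
  set k := ⌊‖x - y‖ / √t⌋₊ with hk
  have hk1 : (k : ℝ) ≤ ‖x - y‖ / √t := Nat.floor_le (by positivity)
  have hk2 : ‖x - y‖ / √t < k + 1 := Nat.lt_floor_add_one _
  have hmem : y ∈ cube x (2 * ((k : ℝ) + 1) * √t) := by
    apply mem_cube_of_norm_sub_le
    rw [div_lt_iff₀ hs] at hk2
    linarith
  refine le_trans ?_ (ENNReal.le_tsum k)
  rw [indicator_of_mem hmem, ← ENNReal.ofReal_mul (by positivity)]
  apply ENNReal.ofReal_le_ofReal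
  have hkk : (k : ℝ) ≤ ‖x - y‖ ^ 2 / t := by
    calc (k : ℝ) ≤ (k : ℝ) ^ 2 := by exact_mod_cast Nat.le_self_pow two_ne_zero k
      _ ≤ (‖x - y‖ / √t) ^ 2 := by gcongr
      _ = ‖x - y‖ ^ 2 / t := by rw [div_pow, Real.sq_sqrt ht.le]
  gcongr
  rw [mul_div_assoc]
  nlinarith

/-- For `0 < t < ρ(x)²` the Gaussian average at scale `√t` is dominated by
`M^{ρ,σ}f(x)`, with a constant depending only on `n`, `σ` and `c`. -/
theorem statement19 (n : ℕ) (σ c : ℝ) (hσ : 0 < σ) (hc : 0 < c) :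
    ∃ C : ℝ, 0 < C ∧
      ∀ (ρ : Rn n → ℝ), IsCriticalRadius ρ →
      ∀ f : Rn n → ℝ, Measurable f → LocallyIntegrable f (volume : Measure (Rn n)) →
      ∀ (x : Rn n) (t : ℝ), 0 < t → t < ρ x ^ 2 →
        (∫⁻ y : Rn n,
            ENNReal.ofReal (t ^ (-(n : ℝ) / 2) * Real.exp (-c * ‖x - y‖ ^ 2 / t) * |f y|)) ≤
          ENNReal.ofReal C * fracMax n ρ σ 0 f x := by
  set m : ℕ := ⌈σ⌉₊
  have hsum := summable_exp_mul_pow hc (m + n)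
  refine ⟨_, hsum.tsum_pos (fun k => by positivity) 0 (by positivity), ?_⟩
  rintro ρ ⟨_, _, -, -, hρ, -⟩ f hf - x t ht htρ
  have hs : 0 < √t := Real.sqrt_pos.2 ht
  have hsρ : √t ≤ ρ x := Real.sqrt_le_iff.2 ⟨(hρ x).le, htρ.le⟩
  have hcube (k : ℕ) : ENNReal.ofReal (t ^ (-(n : ℝ) / 2) * Real.exp (-c * k)) *
      ∫⁻ y in cube x (2 * ((k : ℝ) + 1) * √t), ENNReal.ofReal |f y| ≤
      ENNReal.ofReal (Real.exp (-c * k) * (2 * (k : ℝ) + 3) ^ (m + n)) *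
        fracMax n ρ σ 0 f x := by
    set r := 2 * ((k : ℝ) + 1) * √t with hr
    have hr0 : 0 < r := by positivity
    have hmem : x ∈ cube x r := mem_cube_of_norm_sub_le (by simpa using (half_pos hr0).le)
    refine (mul_le_mul_right (lintegral_cube_le_fracMax ρ σ f hr0 hmem (hρ x)) _).trans ?_
    rw [← mul_assoc, ← ENNReal.ofReal_mul (by positivity)]
    refine mul_le_mul_left (ENNReal.ofReal_le_ofReal ?_) _
    have hψ : psi ρ σ x r ≤ (2 * (k : ℝ) + 3) ^ m := by
      have h1 : 1 + r / ρ x ≤ 2 * (k : ℝ) + 3 := by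
        have : r / ρ x ≤ 2 * ((k : ℝ) + 1) := by
          rw [div_le_iff₀ (hρ x)]
          rw [hr]
          gcongr
        linarith
      have h0 : 0 ≤ 1 + r / ρ x := by
        have := hρ x
        positivity
      calc psi ρ σ x r ≤ (2 * (k : ℝ) + 3) ^ σ := Real.rpow_le_rpow h0 h1 hσ.le
        _ ≤ (2 * (k : ℝ) + 3) ^ (m : ℝ) :=
          Real.rpow_le_rpow_of_exponent_le (by linarith [(k.cast_nonneg : (0 : ℝ) ≤ k)])
            (Nat.le_ceil σ)
        _ = _ := Real.rpow_natCast _ _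
    have ht1 : t ^ (-(n : ℝ) / 2) * √t ^ n = 1 := by
      rw [Real.sqrt_eq_rpow, ← Real.rpow_mul_natCast ht.le, ← Real.rpow_add ht,
        show -(n : ℝ) / 2 + 1 / 2 * n = 0 by ring, Real.rpow_zero]
    calc t ^ (-(n : ℝ) / 2) * Real.exp (-c * k) * (psi ρ σ x r * r ^ n)
        = Real.exp (-c * k) * (psi ρ σ x r * (2 * ((k : ℝ) + 1)) ^ n) *
          (t ^ (-(n : ℝ) / 2) * √t ^ n) := by rw [hr, mul_pow]; ring
      _ ≤ Real.exp (-c * k) * ((2 * (k : ℝ) + 3) ^ m * (2 * (k : ℝ) + 3) ^ n) := by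
        rw [ht1, mul_one]
        gcongr
        linarith
      _ = _ := by rw [pow_add]
  have hfm : Measurable fun y => ENNReal.ofReal |f y| :=
    (continuous_abs.measurable.comp hf).ennreal_ofReal
  calc ∫⁻ y : Rn n,
        ENNReal.ofReal (t ^ (-(n : ℝ) / 2) * Real.exp (-c * ‖x - y‖ ^ 2 / t) * |f y|)
      ≤ ∫⁻ y : Rn n, ∑' k : ℕ, ENNReal.ofReal (t ^ (-(n : ℝ) / 2) * Real.exp (-c * k)) *
          (cube x (2 * ((k : ℝ) + 1) * √t)).indicator (fun y => ENNReal.ofReal |f y|) y :=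
        lintegral_mono fun y => ofReal_gaussian_mul_le_tsum hc ht f x y
    _ = ∑' k : ℕ, ENNReal.ofReal (t ^ (-(n : ℝ) / 2) * Real.exp (-c * k)) *
          ∫⁻ y in cube x (2 * ((k : ℝ) + 1) * √t), ENNReal.ofReal |f y| := by
        rw [lintegral_tsum fun k =>
          ((hfm.indicator (measurableSet_cube _ _)).const_mul _).aemeasurable]
        refine tsum_congr fun k => ?_
        rw [lintegral_const_mul _ (hfm.indicator (measurableSet_cube _ _)),
          lintegral_indicator (measurableSet_cube _ _)]
    _ ≤ ∑' k : ℕ, ENNReal.ofReal (Real.exp (-c * k) * (2 * (k : ℝ) + 3) ^ (m + n)) *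
          fracMax n ρ σ 0 f x := ENNReal.tsum_le_tsum hcube
    _ = _ := by
        rw [ENNReal.tsum_mul_right,
          ENNReal.ofReal_tsum_of_nonneg (fun k => by positivity) hsum]
end
end
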